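/- The matrix Θ̂(τ) is a surrogate inverse of Σ̂ in the following sense: for every j ∈ {1,…,p}, the j-th coordinate of Σ̂Θ̂_j(τ_j) equals 1 (i.e. (e_j − Σ̂Θ̂_j(τ_j))_j = 0), and for every k ≠ j we have |(e_j − Σ̂Θ̂_j(τ_j))_k| ≤ λ̲ τ_j / τ̃_j²(τ_j); consequently ‖e_j − Σ̂Θ̂_j(τ_j)‖_∞ ≤ λ̲ τ_j / τ̃_j²(τ_j). -/

import Mathlib

open Finset Matrix

/-- `‖v‖_n = √(vᵀv/n)`. -/
noncomputable def normN {n : ℕ} (v : Fin n → ℝ) : ℝ :=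
  Real.sqrt ((∑ i, v i ^ 2) / n)

/-- `ℓ₁`-norm of a vector. -/
noncomputable def l1norm {p : ℕ} (v : Fin p → ℝ) : ℝ := ∑ j, |v j|

/-- `ℓ_∞`-norm of a vector. -/
noncomputable def lsup {p : ℕ} (v : Fin p → ℝ) : ℝ := ⨆ j, |v j|

/-- `β_S`: the vector `β` with entries outside `S` set to zero. -/
def sub0 {p : ℕ} (S : Finset (Fin p)) (β : Fin p → ℝ) : Fin p → ℝ :=
  fun j => if j ∈ S then β j else 0

/-- The compatibility constant squared `φ̂²(L,S)`. -/
noncomputable def compatSq {n p : ℕ} (X : Matrix (Fin n) (Fin p) ℝ) (L : ℝ)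
    (S : Finset (Fin p)) : ℝ :=
  sInf { r | ∃ β : Fin p → ℝ, l1norm (sub0 S β) = 1 ∧ l1norm (sub0 Sᶜ β) ≤ L ∧
    r = S.card * (normN (X.mulVec (sub0 S β) - X.mulVec (sub0 Sᶜ β))) ^ 2 }

theorem normN_sq {n : ℕ} (v : Fin n → ℝ) : normN v ^ 2 = (n : ℝ)⁻¹ * (v ⬝ᵥ v) := by
  rw [normN, Real.sq_sqrt (by positivity), div_eq_inv_mul]
  simp only [dotProduct, sq]

theorem l1norm_nonneg {p : ℕ} (v : Fin p → ℝ) : 0 ≤ l1norm v :=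
  Finset.sum_nonneg fun _ _ => abs_nonneg _

theorem l1norm_add_le {p : ℕ} (v w : Fin p → ℝ) : l1norm (v + w) ≤ l1norm v + l1norm w := by
  simp only [l1norm, ← Finset.sum_add_distrib, Pi.add_apply]
  exact Finset.sum_le_sum fun _ _ => abs_add_le _ _

theorem l1norm_smul {p : ℕ} (t : ℝ) (v : Fin p → ℝ) : l1norm (t • v) = |t| * l1norm v := by
  simp only [l1norm, Finset.mul_sum, Pi.smul_apply, smul_eq_mul, abs_mul]

theorem l1norm_single {p : ℕ} (k : Fin p) (a : ℝ) : l1norm (Pi.single k a) = |a| := by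
  rw [l1norm, Finset.sum_eq_single k] <;> simp +contextual

theorem nonpos_of_forall_mul_le_sq_mul {a q : ℝ}
    (h : ∀ t : ℝ, 0 < t → t ≤ 1 → t * a ≤ t ^ 2 * q) : a ≤ 0 := by
  by_contra! ha
  have h1 := h 1 one_pos le_rfl
  have hq : 0 < q := by linarith
  have h2 := h (a / (2 * q)) (by positivity) (by rw [div_le_one (by positivity)]; linarith)
  have h3 : (a / (2 * q)) ^ 2 * q = a / (2 * q) * (a / 2) := by field_simp
  have h4 : 0 < a / (2 * q) := by positivity
  rw [h3] at h2
  linarith [le_of_mul_le_mul_left h2 h4]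

/-- First-order optimality of a Lasso minimizer in a feasible direction `d` along which the
`ℓ₁`-norm grows at rate at most `s`. -/
theorem lasso_directional_bound {n p : ℕ} (X : Matrix (Fin n) (Fin p) ℝ) (y : Fin n → ℝ)
    {μ : ℝ} (hμ : 0 < μ) (j : Fin p) (γ d : Fin p → ℝ) (hγj : γ j = 0) (hdj : d j = 0)
    (hγ : ∀ β : Fin p → ℝ, β j = 0 →
      normN (y - X *ᵥ γ) ^ 2 + 2 * μ * l1norm γ ≤ normN (y - X *ᵥ β) ^ 2 + 2 * μ * l1norm β)
    {s : ℝ} (hs : ∀ t : ℝ, 0 < t → t ≤ 1 → l1norm (γ + t • d) ≤ l1norm γ + t * s) :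
    (n : ℝ)⁻¹ * ((y - X *ᵥ γ) ⬝ᵥ (X *ᵥ d)) ≤ μ * s := by
  set r := y - X *ᵥ γ with hr
  have key : 2 * ((n : ℝ)⁻¹ * (r ⬝ᵥ (X *ᵥ d)) - μ * s) ≤ 0 := by
    refine nonpos_of_forall_mul_le_sq_mul (q := (n : ℝ)⁻¹ * ((X *ᵥ d) ⬝ᵥ (X *ᵥ d))) ?_
    intro t ht ht1
    have h := hγ (γ + t • d) (by simp [hγj, hdj])
    have hres : y - X *ᵥ (γ + t • d) = r - t • (X *ᵥ d) := by
      rw [mulVec_add, mulVec_smul, hr, sub_sub]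
    have hexp : (r - t • (X *ᵥ d)) ⬝ᵥ (r - t • (X *ᵥ d)) =
        r ⬝ᵥ r - 2 * t * (r ⬝ᵥ (X *ᵥ d)) + t ^ 2 * ((X *ᵥ d) ⬝ᵥ (X *ᵥ d)) := by
      simp only [sub_dotProduct, dotProduct_sub, smul_dotProduct, dotProduct_smul, smul_eq_mul,
        dotProduct_comm (X *ᵥ d) r]
      ring
    rw [hres, normN_sq, normN_sq, hexp] at h
    have h' := mul_le_mul_of_nonneg_left (hs t ht ht1) hμ.le
    linarith
  linarith

/-- The Karush–Kuhn–Tucker bound on the coordinates over which the Lasso is minimized. -/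
theorem lasso_abs_correlation_le {n p : ℕ} (X : Matrix (Fin n) (Fin p) ℝ) (y : Fin n → ℝ)
    {μ : ℝ} (hμ : 0 < μ) (j : Fin p) (γ : Fin p → ℝ) (hγj : γ j = 0)
    (hγ : ∀ β : Fin p → ℝ, β j = 0 →
      normN (y - X *ᵥ γ) ^ 2 + 2 * μ * l1norm γ ≤ normN (y - X *ᵥ β) ^ 2 + 2 * μ * l1norm β)
    {k : Fin p} (hk : k ≠ j) :
    |(n : ℝ)⁻¹ * ((y - X *ᵥ γ) ⬝ᵥ X.col k)| ≤ μ := by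
  have h (a : ℝ) (ha : |a| = 1) := lasso_directional_bound X y hμ j γ (Pi.single k a) hγj
    (by simp [hk.symm]) hγ (s := 1) fun t ht _ => by
      refine (l1norm_add_le _ _).trans_eq ?_
      rw [l1norm_smul, l1norm_single, ha, abs_of_pos ht]
  have h1 := h 1 (by simp)
  have h2 := h (-1) (by simp)
  simp only [mulVec_single, MulOpposite.op_neg, MulOpposite.op_one, neg_smul, one_smul,
    dotProduct_neg, mul_one] at h1 h2
  rw [abs_le]
  constructor <;> linarith

/-- The Karush–Kuhn–Tucker equality obtained by rescaling a Lasso minimizer. -/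
theorem lasso_correlation_fit {n p : ℕ} (X : Matrix (Fin n) (Fin p) ℝ) (y : Fin n → ℝ)
    {μ : ℝ} (hμ : 0 < μ) (j : Fin p) (γ : Fin p → ℝ) (hγj : γ j = 0)
    (hγ : ∀ β : Fin p → ℝ, β j = 0 →
      normN (y - X *ᵥ γ) ^ 2 + 2 * μ * l1norm γ ≤ normN (y - X *ᵥ β) ^ 2 + 2 * μ * l1norm β) :
    (n : ℝ)⁻¹ * ((y - X *ᵥ γ) ⬝ᵥ (X *ᵥ γ)) = μ * l1norm γ := by
  have h1 := lasso_directional_bound X y hμ j γ γ hγj hγj hγ (s := l1norm γ) fun t ht _ => by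
    refine (l1norm_add_le _ _).trans_eq ?_
    rw [l1norm_smul, abs_of_pos ht]
  have h2 := lasso_directional_bound X y hμ j γ (-γ) hγj (by simp [hγj]) hγ (s := -l1norm γ)
    fun t _ ht1 => by
      have hscale : γ + t • -γ = (1 - t) • γ := by module
      rw [hscale, l1norm_smul, abs_of_nonneg (by linarith)]
      linarith
  rw [mulVec_neg, dotProduct_neg] at h2
  linarith

theorem surrogate_inverse
    {n p : ℕ} (X : Matrix (Fin n) (Fin p) ℝ)
    (Sighat : Matrix (Fin p) (Fin p) ℝ) (hSighat : Sighat = (n : ℝ)⁻¹ • (Xᵀ * X))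
    (lamu : ℝ) (hlamu : 0 < lamu)
    (j : Fin p) (τj : ℝ) (hτj : 0 < τj)
    (γhat : Fin p → ℝ) (hγhatj : γhat j = 0)
    -- the node-wise Lasso: γ̂_j(τ_j) minimizes over vectors with zero j-th entry
    (hγhat : ∀ γ : Fin p → ℝ, γ j = 0 →
      (normN ((fun i => X i j) - X.mulVec γhat)) ^ 2 + 2 * lamu * τj * l1norm γhat ≤
        (normN ((fun i => X i j) - X.mulVec γ)) ^ 2 + 2 * lamu * τj * l1norm γ)
    (τtsq : ℝ)
    (hτtsq : τtsq =
      (normN ((fun i => X i j) - X.mulVec γhat)) ^ 2 + lamu * τj * l1norm γhat)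
    (hτtsq0 : τtsq ≠ 0)
    (Θj : Fin p → ℝ) (hΘj : Θj = fun k => if k = j then 1 / τtsq else -γhat k / τtsq)
    (ej : Fin p → ℝ) (hej : ej = fun k => if k = j then 1 else 0) :
    (ej - Sighat.mulVec Θj) j = 0 ∧
      (∀ k, k ≠ j → |(ej - Sighat.mulVec Θj) k| ≤ lamu * τj / τtsq) ∧
      lsup (ej - Sighat.mulVec Θj) ≤ lamu * τj / τtsq := by
  subst hej hSighat
  have hμ : 0 < lamu * τj := mul_pos hlamu hτj
  have hmin : ∀ β : Fin p → ℝ, β j = 0 →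
      normN (X.col j - X *ᵥ γhat) ^ 2 + 2 * (lamu * τj) * l1norm γhat ≤
        normN (X.col j - X *ᵥ β) ^ 2 + 2 * (lamu * τj) * l1norm β := fun β hβ => by
    rw [← mul_assoc]
    exact hγhat β hβ
  change τtsq = normN (X.col j - X *ᵥ γhat) ^ 2 + _ at hτtsq
  have hpos : 0 < τtsq := lt_of_le_of_ne
    (hτtsq ▸ add_nonneg (sq_nonneg _) (mul_nonneg hμ.le (l1norm_nonneg _))) hτtsq0.symm
  have hΘ : Θj = τtsq⁻¹ • (Pi.single j 1 - γhat) := by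
    ext k
    by_cases hk : k = j
    · subst hk
      simp [hΘj, hγhatj]
    · simp [hΘj, hk, div_eq_inv_mul]
  have hcoord (k : Fin p) : (((n : ℝ)⁻¹ • (Xᵀ * X)) *ᵥ Θj) k =
      (n : ℝ)⁻¹ * ((X.col j - X *ᵥ γhat) ⬝ᵥ X.col k) / τtsq := by
    rw [hΘ, smul_mulVec, mulVec_smul, ← mulVec_mulVec, mulVec_sub, mulVec_single_one,
      dotProduct_comm, Pi.smul_apply, Pi.smul_apply, smul_eq_mul, smul_eq_mul, div_eq_inv_mul,
      mul_left_comm]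
    rfl
  have hdiag : (n : ℝ)⁻¹ * ((X.col j - X *ᵥ γhat) ⬝ᵥ X.col j) = τtsq := by
    rw [hτtsq, normN_sq, ← lasso_correlation_fit X (X.col j) hμ j γhat hγhatj hmin, ← mul_add,
      ← dotProduct_add, sub_add_cancel]
  have hj : ((fun k => if k = j then (1 : ℝ) else 0) -
      ((n : ℝ)⁻¹ • (Xᵀ * X)) *ᵥ Θj) j = 0 := by
    rw [Pi.sub_apply, hcoord, hdiag, div_self hτtsq0, if_pos rfl, sub_self]
  have hoff (k : Fin p) (hk : k ≠ j) : |((fun k => if k = j then (1 : ℝ) else 0) -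
      ((n : ℝ)⁻¹ • (Xᵀ * X)) *ᵥ Θj) k| ≤ lamu * τj / τtsq := by
    rw [Pi.sub_apply, hcoord, if_neg hk, zero_sub, abs_neg, abs_div, abs_of_pos hpos]
    gcongr
    exact lasso_abs_correlation_le X (X.col j) hμ j γhat hγhatj hmin hk
  refine ⟨hj, hoff, ?_⟩
  have : Nonempty (Fin p) := ⟨j⟩
  refine ciSup_le fun k => ?_
  by_cases hk : k = j
  · rw [hk, hj, abs_zero]
    positivity
  · exact hoff k hk
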